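/- Let S be a non-empty finite set and x an S-cube in an abelian category such that all faces of x are admissible. Then: (1) for any k ∈ S and any p ≥ 2, H_p(Tot x) = 0, and for p = 0, 1 there are isomorphisms H_p(Tot x) ≅ H_p^k(H_0^{S∖{k}}(x)), where H_0^{S∖{k}}(x) is the {k}-cube obtained by applying the cokernel functors H_0^s successively for all s ∈ S∖{k}, H_0^k of a {k}-cube is the cokernel of its boundary morphism, and H_1^k is its kernel. (2) In particular, if x is admissible, then H_p(Tot x) = 0 for all p ≠ 0 and H_0(Tot x) ≅ H_0^S(x), the iterated cokernel of x over all directions. -/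

import Mathlib

open CategoryTheory CategoryTheory.Limits Opposite

attribute [local instance] CategoryTheory.Abelian.hasFiniteBiproducts

set_option linter.unusedSectionVars false

universe w v u

/-- An `ι`-cube in a category `𝒜`: a contravariant functor from the poset of finite
subsets of `ι` (ordered by inclusion) to `𝒜`.  An `S`-cube (for `S : Finset ι`) is such a
functor, of which only the values on subsets of `S` are relevant. -/
abbrev Cube (𝒜 : Type u) [Category.{v} 𝒜] (ι : Type w) := (Finset ι)ᵒᵖ ⥤ 𝒜

namespace Cube

variable {𝒜 : Type u} [Category.{v} 𝒜] {ι : Type w} [DecidableEq ι]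

/-- The vertex `x_T` of a cube `x` at a finite subset `T`. -/
def vtx (x : Cube 𝒜 ι) (T : Finset ι) : 𝒜 := x.obj (op T)

/-- The structure morphism `x_T ⟶ x_U` of a cube for `U ⊆ T`. -/
def mapLE (x : Cube 𝒜 ι) {T U : Finset ι} (h : U ⊆ T) : x.vtx T ⟶ x.vtx U :=
  x.map (homOfLE h).op

lemma mapLE_refl (x : Cube 𝒜 ι) (T : Finset ι) (h : T ⊆ T) : x.mapLE h = 𝟙 (x.vtx T) := by
  show x.map (homOfLE h).op = _
  rw [show (homOfLE h).op = 𝟙 (op T) from rfl, x.map_id]; rfl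

lemma mapLE_comp (x : Cube 𝒜 ι) {T U V : Finset ι} (h1 : U ⊆ T) (h2 : V ⊆ U) :
    x.mapLE h1 ≫ x.mapLE h2 = x.mapLE (h2.trans h1) := by
  show x.map _ ≫ x.map _ = x.map _
  rw [← x.map_comp]
  rfl

/-- The `k`-direction boundary morphism `d^k_T : x_T ⟶ x_{T ∖ {k}}` of a cube. -/
def bd (x : Cube 𝒜 ι) (T : Finset ι) (k : ι) : x.vtx T ⟶ x.vtx (T.erase k) :=
  x.mapLE (Finset.erase_subset k T)

/-- The `k`-direction `0`-th homology `H⁰ₖ(x)` of a cube in an abelian category, an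
`(S ∖ {k})`-cube: its vertex at `T` is the cokernel of the boundary morphism
`d^k_{T ∪ {k}} : x_{T ∪ {k}} ⟶ x_{(T ∪ {k}) ∖ {k}}`. -/
noncomputable def H0 [Abelian 𝒜] (x : Cube 𝒜 ι) (k : ι) : Cube 𝒜 ι where
  obj T := cokernel (x.bd (insert k T.unop) k)
  map {T U} f :=
    cokernel.map _ _
      (x.mapLE (Finset.insert_subset_insert k (leOfHom f.unop)))
      (x.mapLE (Finset.erase_subset_erase k (Finset.insert_subset_insert k (leOfHom f.unop))))
      (by rw [bd, bd, mapLE_comp, mapLE_comp])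
  map_id T := by
    apply coequalizer.hom_ext
    simp [cokernel.map]
    rw [mapLE_refl]
    simp
  map_comp {T U V} f g := by
    apply coequalizer.hom_ext
    simp [cokernel.map]
    rw [← Category.assoc, mapLE_comp]

/-- Admissibility of an `S`-cube `x` in an abelian category, by recursion on `#S`:
`x` is admissible if all its boundary morphisms `d^k_T` (`k ∈ T ⊆ S`) are monomorphisms and
for every `k ∈ S` the `(S ∖ {k})`-cube `H⁰ₖ(x)` is admissible.  (For `S = ∅` the conditions
are vacuous, and for `#S = 1` this says exactly that the boundary morphism of `x` is a
monomorphism.) -/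
def Admissible [Abelian 𝒜] (x : Cube 𝒜 ι) (S : Finset ι) : Prop :=
  (∀ T ⊆ S, ∀ k ∈ T, Mono (x.bd T k)) ∧
  ∀ k, (hk : k ∈ S) → Admissible (x.H0 k) (S.erase k)
termination_by S.card
decreasing_by exact Finset.card_erase_lt_of_mem hk

/-- Iterated `0`-th homology:
`H0s x [i₁, …, i_r] = H⁰_{i₁}(H⁰_{i₂}(⋯(H⁰_{i_r}(x))⋯))`. -/
noncomputable def H0s [Abelian 𝒜] (x : Cube 𝒜 ι) : List ι → Cube 𝒜 ι
  | [] => x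
  | k :: ks => (x.H0s ks).H0 k

/-- The restriction `x|_U^V` of a cube to `U` along `V` (for disjoint `U`, `V`): the
`U`-cube `T ↦ x_{T ∪ V}`.  (It is implemented as the cube `T ↦ x_{(T ∩ U) ∪ V}`, whose
vertex at any subset `T ⊆ U` is exactly `x_{T ∪ V}`.) -/
def res (x : Cube 𝒜 ι) (U V : Finset ι) : Cube 𝒜 ι :=
  (Monotone.functor (f := fun T : Finset ι => (T ∩ U) ∪ V)
    (fun _ _ h => Finset.union_subset_union (Finset.inter_subset_inter h (subset_refl U))
      (subset_refl V))).op ⋙ x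

/-- The `n`-th object `(Tot x)_n = ⊕_{T ⊆ S, #T = n} x_T` of the total complex of an
`S`-cube. -/
noncomputable def totObj [Abelian 𝒜] (x : Cube 𝒜 ι) (S : Finset ι) (n : ℕ) : 𝒜 :=
  ⨁ (fun T : {T : Finset ι // T ∈ Finset.powersetCard n S} => x.vtx T.1)

/-- The differential `(Tot x)_{n+1} ⟶ (Tot x)_n` of the total complex of an `S`-cube:
its component from `x_T` to `x_{T ∖ {j}}` (for `j ∈ T`) is `(-1)^{#{t ∈ T | t > j}} ⬝ d^j_T`. -/
noncomputable def totD [Abelian 𝒜] [LinearOrder ι] (x : Cube 𝒜 ι) (S : Finset ι) (n : ℕ) :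
    x.totObj S (n+1) ⟶ x.totObj S n := by
  unfold totObj
  exact biproduct.desc fun (T : {T : Finset ι // T ∈ Finset.powersetCard (n+1) S}) =>
    biproduct.lift fun (T' : {T : Finset ι // T ∈ Finset.powersetCard n S}) =>
      ∑ j ∈ T.1, if h : T'.1 = T.1.erase j then
        ((-1 : ℤ) ^ (T.1.filter (fun t => j < t)).card) •
          (x.bd T.1 j ≫ eqToHom (congrArg x.vtx h.symm))
      else 0

end Cube

section ConeAbs

variable {𝒜 : Type u} [Category.{v} 𝒜] [Abelian 𝒜]

/-- surjectivity up to refinements -/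
def ExRef {X Y Z : 𝒜} (f : X ⟶ Y) (g : Y ⟶ Z) : Prop :=
  ∀ ⦃W : 𝒜⦄ (z : W ⟶ Y), z ≫ g = 0 →
    ∃ (W' : 𝒜) (p : W' ⟶ W) (_ : Epi p) (y : W' ⟶ X), p ≫ z = y ≫ f

lemma ExRef.exact {X Y Z : 𝒜} {f : X ⟶ Y} {g : Y ⟶ Z} (h : ExRef f g) (w : f ≫ g = 0) :
    (ShortComplex.mk f g w).Exact := by
  rw [ShortComplex.exact_iff_exact_up_to_refinements]
  intro W z hz
  exact h z hz

lemma exRef_of_exact {X Y Z : 𝒜} {f : X ⟶ Y} {g : Y ⟶ Z} {w : f ≫ g = 0}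
    (h : (ShortComplex.mk f g w).Exact) : ExRef f g := by
  rw [ShortComplex.exact_iff_exact_up_to_refinements] at h
  intro W z hz
  exact h z hz

/-- `X` is a resolution of `N`. -/
structure ResSeq (X : ℕ → 𝒜) (d : ∀ n, X (n+1) ⟶ X n) (N : 𝒜) (q : X 0 ⟶ N) : Prop where
  ex : ∀ n, ExRef (d (n+1)) (d n)
  ex0 : ExRef (d 0) q
  epi : Epi q
  w : d 0 ≫ q = 0

/-- Explicit cone decomposition. -/
structure ConeData (A : ℕ → 𝒜) (dA : ∀ n, A (n+1) ⟶ A n) (B : ℕ → 𝒜)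
    (dB : ∀ n, B (n+1) ⟶ B n) (C : ℕ → 𝒜) (dC : ∀ n, C (n+1) ⟶ C n)
    (f : ∀ n, A n ⟶ B n) where
  inl : ∀ n, A n ⟶ C (n+1)
  inr : ∀ n, B n ⟶ C n
  fst : ∀ n, C (n+1) ⟶ A n
  snd : ∀ n, C n ⟶ B n
  inl_fst : ∀ n, inl n ≫ fst n = 𝟙 _
  inr_snd : ∀ n, inr n ≫ snd n = 𝟙 _
  inr_fst : ∀ n, inr (n+1) ≫ fst n = 0
  inl_snd : ∀ n, inl n ≫ snd (n+1) = 0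
  tot : ∀ n, fst n ≫ inl n + snd (n+1) ≫ inr (n+1) = 𝟙 _
  tot0 : snd 0 ≫ inr 0 = 𝟙 _
  f_comm : ∀ n, f (n+1) ≫ dB n = dA n ≫ f n
  inr_d : ∀ n, inr (n+1) ≫ dC n = dB n ≫ inr n
  inl_d : ∀ n, inl (n+1) ≫ dC (n+1) = - dA n ≫ inl n + f (n+1) ≫ inr (n+1)
  inl_d0 : inl 0 ≫ dC 0 = f 0 ≫ inr 0

namespace ConeData

variable {A : ℕ → 𝒜} {dA : ∀ n, A (n+1) ⟶ A n} {B : ℕ → 𝒜}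
    {dB : ∀ n, B (n+1) ⟶ B n} {C : ℕ → 𝒜} {dC : ∀ n, C (n+1) ⟶ C n}
    {f : ∀ n, A n ⟶ B n} (D : ConeData A dA B dB C dC f)

include D

lemma mono_inr (n : ℕ) : Mono (D.inr n) := by
  have : Mono (D.inr n ≫ D.snd n) := by rw [D.inr_snd]; infer_instance
  exact mono_of_mono (D.inr n) (D.snd n)

lemma decomp {W : 𝒜} {n : ℕ} (z : W ⟶ C (n+1)) :
    z = (z ≫ D.fst n) ≫ D.inl n + (z ≫ D.snd (n+1)) ≫ D.inr (n+1) := by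
  have := congrArg (fun t => z ≫ t) (D.tot n)
  simpa using this.symm

lemma d_eq {n : ℕ} : dC (n+1) =
    D.fst (n+1) ≫ (- dA n ≫ D.inl n + f (n+1) ≫ D.inr (n+1))
      + D.snd (n+2) ≫ dB (n+1) ≫ D.inr (n+1) := by
  rw [← D.inl_d, ← D.inr_d, ← Category.assoc, ← Category.assoc, ← Preadditive.add_comp, D.tot,
    Category.id_comp]

lemma d0_eq : dC 0 =
    D.fst 0 ≫ f 0 ≫ D.inr 0 + D.snd 1 ≫ dB 0 ≫ D.inr 0 := by
  rw [← D.inl_d0, ← D.inr_d, ← Category.assoc, ← Category.assoc, ← Preadditive.add_comp, D.tot,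
    Category.id_comp]

lemma d_comp (hA : ∀ n, dA (n+1) ≫ dA n = 0) (hB : ∀ n, dB (n+1) ≫ dB n = 0) (n : ℕ) :
    dC (n+1) ≫ dC n = 0 := by
  rw [D.d_eq]
  cases n with
  | zero =>
    simp only [Preadditive.add_comp, Preadditive.comp_add, Category.assoc, D.inl_d0,
      Preadditive.neg_comp, Preadditive.comp_neg, D.inr_d]
    rw [reassoc_of% (D.f_comm 0), reassoc_of% (hB 0)]
    simp
  | succ n =>
    simp only [Preadditive.add_comp, Preadditive.comp_add, Category.assoc, D.inl_d,
      Preadditive.neg_comp, Preadditive.comp_neg, D.inr_d]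
    rw [reassoc_of% (D.f_comm (n+1)), reassoc_of% (hB (n+1)), reassoc_of% (hA n)]
    simp

/-- cycles of the cone, degree 1 -/
lemma cyc0 {W : 𝒜} (z : W ⟶ C 1) (hz : z ≫ dC 0 = 0) :
    z ≫ D.fst 0 ≫ f 0 + z ≫ D.snd 1 ≫ dB 0 = 0 := by
  have := D.mono_inr 0
  rw [← cancel_mono (D.inr 0), zero_comp, ← hz, D.d0_eq]
  simp

lemma cyc {W : 𝒜} {n : ℕ} (z : W ⟶ C (n+2)) (hz : z ≫ dC (n+1) = 0) :
    z ≫ D.fst (n+1) ≫ dA n = 0 := by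
  have h := congrArg (fun t => t ≫ D.fst n) hz
  rw [D.d_eq] at h
  simpa [D.inl_fst, D.inr_fst] using h

/-- common final step of the chase -/
lemma bdry {N : 𝒜} {β : B 0 ⟶ N} (hB : ResSeq B dB N β)
    {W : 𝒜} {n : ℕ} (z : W ⟶ C (n+1)) (hz : z ≫ dC n = 0)
    (hw : ∀ n, dC (n+1) ≫ dC n = 0)
    (a : W ⟶ A (n+1)) (ha : z ≫ D.fst n = a ≫ dA n) :
    ∃ (W' : 𝒜) (p : W' ⟶ W) (_ : Epi p) (y : W' ⟶ C (n+2)), p ≫ z = y ≫ dC (n+1) := by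
  have h1 : z + a ≫ D.inl (n+1) ≫ dC (n+1) =
      (z ≫ D.snd (n+1) + a ≫ f (n+1)) ≫ D.inr (n+1) := by
    conv_lhs => rw [D.decomp z, D.inl_d, ha]
    simp; abel
  have h2 : (z ≫ D.snd (n+1) + a ≫ f (n+1)) ≫ dB n = 0 := by
    have := D.mono_inr n
    rw [← cancel_mono (D.inr n), Category.assoc, ← D.inr_d, ← Category.assoc, ← h1]
    simp [hz, hw]
  obtain ⟨W', p, hp, b, hb⟩ := hB.ex n _ h2
  refine ⟨W', p, hp, b ≫ D.inr (n+2) - p ≫ a ≫ D.inl (n+1), ?_⟩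
  have h3 := congrArg (fun t => p ≫ t) h1
  simp only [Preadditive.comp_add] at h3
  rw [Preadditive.sub_comp, Category.assoc, D.inr_d, ← Category.assoc b, ← hb,
    Category.assoc, ← h1]
  simp

lemma exact_high {M N : 𝒜} {α : A 0 ⟶ M} {β : B 0 ⟶ N} (hA : ResSeq A dA M α)
    (hB : ResSeq B dB N β) (hw : ∀ n, dC (n+1) ≫ dC n = 0) (n : ℕ) :
    ExRef (dC (n+2)) (dC (n+1)) := by
  intro W z hz
  obtain ⟨W', p, hp, a, ha⟩ := hA.ex n (z ≫ D.fst (n+1)) (by simpa using D.cyc z hz)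
  obtain ⟨W'', p', hp', y, hy⟩ := D.bdry hB (p ≫ z) (by simp [hz]) hw a (by simpa using ha)
  exact ⟨W'', p' ≫ p, epi_comp _ _, y, by simpa using hy⟩

lemma homology_iso {M N : 𝒜} {α : A 0 ⟶ M} {β : B 0 ⟶ N} (hA : ResSeq A dA M α)
    (hB : ResSeq B dB N β) (hw : ∀ n, dC (n+1) ≫ dC n = 0)
    (φ : M ⟶ N) (hφ : α ≫ φ = f 0 ≫ β) :
    Nonempty ((ShortComplex.mk (dC 1) (dC 0) (hw 0)).homology ≅ kernel φ) := by
  have hi : (kernel.ι (dC 0) ≫ D.fst 0 ≫ α) ≫ φ = 0 := by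
    have := congrArg (fun t => t ≫ β) (D.cyc0 (kernel.ι (dC 0)) (kernel.condition _))
    simp only [Preadditive.add_comp, Category.assoc, hB.w, comp_zero, add_zero, zero_comp] at this
    simpa [hφ] using this
  let π : kernel (dC 0) ⟶ kernel φ := kernel.lift φ _ hi
  have hπ : π ≫ kernel.ι φ = kernel.ι (dC 0) ≫ D.fst 0 ≫ α := kernel.lift_ι _ _ _
  have hexact : ExRef (kernel.lift (dC 0) (dC 1) (hw 0)) π := by
    intro W z hz
    have h1 : ((z ≫ kernel.ι (dC 0)) ≫ D.fst 0) ≫ α = 0 := by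
      have := congrArg (fun t => t ≫ kernel.ι φ) hz
      simpa [hπ] using this
    obtain ⟨W', p, hp, a, ha⟩ := hA.ex0 _ h1
    obtain ⟨W'', p', hp', y, hy⟩ := D.bdry hB (p ≫ z ≫ kernel.ι (dC 0)) (by simp)
      hw a (by simpa using ha)
    refine ⟨W'', p' ≫ p, epi_comp _ _, y, ?_⟩
    rw [← cancel_mono (kernel.ι (dC 0))]
    simpa using hy
  have hw' : kernel.lift (dC 0) (dC 1) (hw 0) ≫ π = 0 := by
    rw [← cancel_mono (kernel.ι φ), Category.assoc, hπ, kernel.lift_ι_assoc, D.d_eq]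
    simp [reassoc_of% (D.inl_fst 0), reassoc_of% (D.inr_fst 0), hA.w]
  have hepi : Epi π := by
    rw [epi_iff_surjective_up_to_refinements]
    intro W y
    have := hA.epi
    obtain ⟨W₁, p₁, hp₁, a, ha⟩ := surjective_up_to_refinements_of_epi α (y ≫ kernel.ι φ)
    have h1 : (a ≫ f 0) ≫ β = 0 := by
      rw [Category.assoc, ← hφ, ← Category.assoc, ← ha]; simp
    obtain ⟨W₂, p₂, hp₂, b, hb⟩ := hB.ex0 _ h1
    have h2 : (p₂ ≫ a ≫ D.inl 0 - b ≫ D.inr 1) ≫ dC 0 = 0 := by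
      rw [Preadditive.sub_comp, Category.assoc, Category.assoc, Category.assoc, D.inl_d0, D.inr_d,
        ← Category.assoc b, ← hb]
      simp
    refine ⟨W₂, p₂ ≫ p₁, epi_comp _ _, kernel.lift _ _ h2, ?_⟩
    rw [← cancel_mono (kernel.ι φ), Category.assoc, Category.assoc, Category.assoc, hπ, ha]
    simp [reassoc_of% (D.inl_fst 0), reassoc_of% (D.inr_fst 0)]
  have hex := (hexact.exact hw')
  let h : (ShortComplex.mk (dC 1) (dC 0) (hw 0)).LeftHomologyData :=
    { K := kernel (dC 0)
      H := kernel φ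
      i := kernel.ι _
      π := π
      wi := kernel.condition _
      hi := kernelIsKernel _
      wπ := hw'
      hπ := hex.gIsCokernel }
  exact ⟨h.homologyIso⟩

lemma res {M N : 𝒜} {α : A 0 ⟶ M} {β : B 0 ⟶ N} (hA : ResSeq A dA M α)
    (hB : ResSeq B dB N β) (hw : ∀ n, dC (n+1) ≫ dC n = 0)
    (φ : M ⟶ N) (hφ : α ≫ φ = f 0 ≫ β) {P : 𝒜} (ψ : N ⟶ P) [Epi ψ] (hφψ : φ ≫ ψ = 0)
    (hex : ExRef φ ψ) (q : C 0 ⟶ P) (hq : D.inr 0 ≫ q = β ≫ ψ) :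
    Epi q ∧ dC 0 ≫ q = 0 ∧ ExRef (dC 0) q := by
  have hq' : q = D.snd 0 ≫ β ≫ ψ := by
    rw [← hq, ← Category.assoc, D.tot0, Category.id_comp]
  refine ⟨?_, ?_, ?_⟩
  · have := hB.epi
    have : Epi (D.inr 0 ≫ q) := by rw [hq]; exact epi_comp _ _
    exact epi_of_epi (D.inr 0) q
  · rw [D.d0_eq]
    simp only [Preadditive.add_comp, Category.assoc, hq, ← reassoc_of% hφ, hφψ,
      reassoc_of% hB.w, comp_zero, zero_comp, add_zero]
  · intro W z hz
    have := hA.epi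
    obtain ⟨W₁, p₁, hp₁, m, hm⟩ := hex (z ≫ D.snd 0 ≫ β) (by simpa [hq'] using hz)
    obtain ⟨W₂, p₂, hp₂, a, ha⟩ := surjective_up_to_refinements_of_epi α m
    have h1 : (p₂ ≫ p₁ ≫ z ≫ D.snd 0 - a ≫ f 0) ≫ β = 0 := by
      simp only [Preadditive.sub_comp, Category.assoc]
      rw [← hφ, ← reassoc_of% ha, ← hm, sub_self]
    obtain ⟨W₃, p₃, hp₃, b, hb⟩ := hB.ex0 _ h1
    refine ⟨W₃, p₃ ≫ p₂ ≫ p₁, epi_comp _ _, p₃ ≫ a ≫ D.inl 0 + b ≫ D.inr 1, ?_⟩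
    simp only [Preadditive.add_comp, Category.assoc]
    rw [D.inl_d0, D.inr_d, ← reassoc_of% hb]
    simp [D.tot0]

end ConeData

end ConeAbs

namespace Cube

section Functoriality

variable {𝒜 : Type u} [Category.{v} 𝒜] [Abelian 𝒜] {ι : Type w} [LinearOrder ι]

/-- component of a morphism of cubes -/
def cmp {x y : Cube 𝒜 ι} (f : x ⟶ y) (T : Finset ι) : x.vtx T ⟶ y.vtx T := f.app (op T)

lemma mapLE_cmp {x y : Cube 𝒜 ι} (f : x ⟶ y) {T U : Finset ι} (h : U ⊆ T) :
    x.mapLE h ≫ cmp f U = cmp f T ≫ y.mapLE h := f.naturality _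

lemma mapLE_cmp_assoc {x y : Cube 𝒜 ι} (f : x ⟶ y) {T U : Finset ι} (h : U ⊆ T)
    {Z' : 𝒜} (h' : y.vtx U ⟶ Z') : x.mapLE h ≫ cmp f U ≫ h' =
      cmp f T ≫ y.mapLE h ≫ h' := by
  rw [← Category.assoc, mapLE_cmp f h, Category.assoc]

lemma bd_cmp {x y : Cube 𝒜 ι} (f : x ⟶ y) (T : Finset ι) (k : ι) :
    x.bd T k ≫ cmp f (T.erase k) = cmp f T ≫ y.bd T k := f.naturality _

lemma bd_cmp_assoc {x y : Cube 𝒜 ι} (f : x ⟶ y) (T : Finset ι) (k : ι)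
    {Z' : 𝒜} (h' : y.vtx (T.erase k) ⟶ Z') : x.bd T k ≫ cmp f (T.erase k) ≫ h' =
      cmp f T ≫ y.bd T k ≫ h' := by
  rw [← Category.assoc, bd_cmp f T k, Category.assoc]

lemma mapLE_mapLE (x : Cube 𝒜 ι) {T U V : Finset ι} (h1 : U ⊆ T) (h2 : V ⊆ U) :
    x.mapLE h1 ≫ x.mapLE h2 = x.mapLE (h2.trans h1) := mapLE_comp x h1 h2

lemma mapLE_mapLE_assoc (x : Cube 𝒜 ι) {T U V : Finset ι} (h1 : U ⊆ T) (h2 : V ⊆ U)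
    {Z' : 𝒜} (h' : x.vtx V ⟶ Z') : x.mapLE h1 ≫ x.mapLE h2 ≫ h' =
      x.mapLE (h2.trans h1) ≫ h' := by
  rw [← Category.assoc, mapLE_mapLE x h1 h2]

/-- isomorphism for equal sets -/
def isoLE (x : Cube 𝒜 ι) {T U : Finset ι} (h : T = U) : x.vtx T ≅ x.vtx U where
  hom := x.mapLE h.ge
  inv := x.mapLE h.le
  hom_inv_id := by rw [mapLE_comp, mapLE_refl]
  inv_hom_id := by rw [mapLE_comp, mapLE_refl]

/-- projection to a vertex of `H0` -/
noncomputable def H0π (x : Cube 𝒜 ι) (k : ι) (T : Finset ι) :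
    x.vtx ((insert k T).erase k) ⟶ (x.H0 k).vtx T :=
  cokernel.π (x.bd (insert k T) k)

instance (x : Cube 𝒜 ι) (k : ι) (T : Finset ι) : Epi (x.H0π k T) := by
  unfold H0π; exact inferInstanceAs (Epi (coequalizer.π _ _))

lemma bd_H0π (x : Cube 𝒜 ι) (k : ι) (T : Finset ι) : x.bd (insert k T) k ≫ x.H0π k T = 0 :=
  cokernel.condition _

lemma bd_H0π_assoc (x : Cube 𝒜 ι) (k : ι) (T : Finset ι)
    {Z' : 𝒜} (h' : (x.H0 k).vtx T ⟶ Z') : x.bd (insert k T) k ≫ x.H0π k T ≫ h' =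
      0 := by
  rw [← Category.assoc, bd_H0π x k T, zero_comp]

lemma H0π_mapLE (x : Cube 𝒜 ι) (k : ι) {T U : Finset ι} (h : U ⊆ T) :
    x.H0π k T ≫ (x.H0 k).mapLE h =
      x.mapLE (Finset.erase_subset_erase k (Finset.insert_subset_insert k h)) ≫ x.H0π k U :=
  cokernel.π_desc _ _ _

lemma H0π_mapLE_assoc (x : Cube 𝒜 ι) (k : ι) {T U : Finset ι} (h : U ⊆ T)
    {Z' : 𝒜} (h' : (x.H0 k).vtx U ⟶ Z') : x.H0π k T ≫ (x.H0 k).mapLE h ≫ h' =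
      x.mapLE (Finset.erase_subset_erase k (Finset.insert_subset_insert k h)) ≫ x.H0π k U ≫ h' := by
  rw [← Category.assoc, H0π_mapLE x k h, Category.assoc]

/-- map out of a vertex of `H0` -/
noncomputable def H0desc (x : Cube 𝒜 ι) (k : ι) (T : Finset ι) {Z : 𝒜}
    (g : x.vtx ((insert k T).erase k) ⟶ Z) (h : x.bd (insert k T) k ≫ g = 0) :
    (x.H0 k).vtx T ⟶ Z := cokernel.desc _ g h

lemma H0π_desc (x : Cube 𝒜 ι) (k : ι) (T : Finset ι) {Z : 𝒜}
    (g : x.vtx ((insert k T).erase k) ⟶ Z) (h : x.bd (insert k T) k ≫ g = 0) :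
    x.H0π k T ≫ x.H0desc k T g h = g := cokernel.π_desc _ _ _

lemma H0π_desc_assoc (x : Cube 𝒜 ι) (k : ι) (T : Finset ι) {Z : 𝒜}
    (g : x.vtx ((insert k T).erase k) ⟶ Z) (h : x.bd (insert k T) k ≫ g = 0)
    {Z' : 𝒜} (h' : Z ⟶ Z') : x.H0π k T ≫ x.H0desc k T g h ≫ h' =
      g ≫ h' := by
  rw [← Category.assoc, H0π_desc x k T g h]

/-- build a morphism of cubes -/
def mkHom {x y : Cube 𝒜 ι} (c : ∀ T, x.vtx T ⟶ y.vtx T)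
    (h : ∀ {T U : Finset ι} (h : U ⊆ T), x.mapLE h ≫ c U = c T ≫ y.mapLE h) : x ⟶ y where
  app T := c T.unop
  naturality T U f := h (leOfHom f.unop)

lemma cmp_mkHom {x y : Cube 𝒜 ι} (c : ∀ T, x.vtx T ⟶ y.vtx T)
    (h : ∀ {T U : Finset ι} (h : U ⊆ T), x.mapLE h ≫ c U = c T ≫ y.mapLE h) (T : Finset ι) :
    cmp (mkHom c h) T = c T := rfl

lemma hom_ext' {x y : Cube 𝒜 ι} {f g : x ⟶ y} (h : ∀ T, cmp f T = cmp g T) : f = g := by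
  ext T; exact h T.unop

lemma cmp_comp {x y z : Cube 𝒜 ι} (f : x ⟶ y) (g : y ⟶ z) (T : Finset ι) :
    cmp (f ≫ g) T = cmp f T ≫ cmp g T := rfl

lemma cmp_id (x : Cube 𝒜 ι) (T : Finset ι) : cmp (𝟙 x) T = 𝟙 _ := rfl

/-- functoriality of `H0` -/
noncomputable def H0map {x y : Cube 𝒜 ι} (f : x ⟶ y) (k : ι) : x.H0 k ⟶ y.H0 k :=
  mkHom (fun T => x.H0desc k T (cmp f _ ≫ y.H0π k T)
    (by rw [bd_cmp_assoc, bd_H0π, comp_zero])) (by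
      intro T U h
      rw [← cancel_epi (x.H0π k T), H0π_mapLE_assoc, H0π_desc, H0π_desc_assoc, mapLE_cmp_assoc,
        Category.assoc, H0π_mapLE])

lemma H0π_H0map {x y : Cube 𝒜 ι} (f : x ⟶ y) (k : ι) (T : Finset ι) :
    x.H0π k T ≫ cmp (H0map f k) T = cmp f _ ≫ y.H0π k T := H0π_desc _ _ _ _ _

lemma H0π_H0map_assoc {x y : Cube 𝒜 ι} (f : x ⟶ y) (k : ι) (T : Finset ι)
    {Z' : 𝒜} (h' : (y.H0 k).vtx T ⟶ Z') : x.H0π k T ≫ cmp (H0map f k) T ≫ h' =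
      cmp f _ ≫ y.H0π k T ≫ h' := by
  rw [← Category.assoc, H0π_H0map f k T, Category.assoc]

lemma H0map_comp {x y z : Cube 𝒜 ι} (f : x ⟶ y) (g : y ⟶ z) (k : ι) :
    H0map (f ≫ g) k = H0map f k ≫ H0map g k := by
  apply hom_ext'
  intro T
  rw [← cancel_epi (x.H0π k T), H0π_H0map, cmp_comp, cmp_comp, H0π_H0map_assoc, H0π_H0map,
    Category.assoc]

lemma H0map_id (x : Cube 𝒜 ι) (k : ι) : H0map (𝟙 x) k = 𝟙 _ := by
  apply hom_ext'
  intro T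
  rw [← cancel_epi (x.H0π k T), H0π_H0map, cmp_id, cmp_id, Category.id_comp]
  exact (Category.comp_id _).symm

/-- `H0` on isomorphisms -/
noncomputable def H0iso {x y : Cube 𝒜 ι} (e : x ≅ y) (k : ι) : x.H0 k ≅ y.H0 k where
  hom := H0map e.hom k
  inv := H0map e.inv k
  hom_inv_id := by rw [← H0map_comp, e.hom_inv_id, H0map_id]
  inv_hom_id := by rw [← H0map_comp, e.inv_hom_id, H0map_id]

/-- augmentation -/
noncomputable def aug (x : Cube 𝒜 ι) (k : ι) : x ⟶ x.H0 k :=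
  mkHom (fun T => x.mapLE (by
    intro a; simp) ≫ x.H0π k T) (by
      intro T U h
      rw [Category.assoc, H0π_mapLE, mapLE_mapLE_assoc, mapLE_mapLE_assoc])

lemma cmp_aug (x : Cube 𝒜 ι) (k : ι) (T : Finset ι) (h : (insert k T).erase k ⊆ T) :
    cmp (x.aug k) T = x.mapLE h ≫ x.H0π k T := rfl

lemma aug_nat {x y : Cube 𝒜 ι} (f : x ⟶ y) (k : ι) : x.aug k ≫ H0map f k = f ≫ y.aug k := by
  apply hom_ext'
  intro T
  have h : (insert k T).erase k ⊆ T := by intro a; simp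
  rw [cmp_comp, cmp_comp, cmp_aug _ _ _ h, cmp_aug _ _ _ h, Category.assoc, H0π_H0map,
    mapLE_cmp_assoc]

/-- iterated -/
noncomputable def H0smap {x y : Cube 𝒜 ι} (f : x ⟶ y) : ∀ l : List ι, x.H0s l ⟶ y.H0s l
  | [] => f
  | k :: ks => H0map (H0smap f ks) k

/-- iterated -/
noncomputable def augs (x : Cube 𝒜 ι) : ∀ l : List ι, x ⟶ x.H0s l
  | [] => 𝟙 x
  | k :: ks => augs x ks ≫ (x.H0s ks).aug k

lemma augs_nat {x y : Cube 𝒜 ι} (f : x ⟶ y) (l : List ι) :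
    x.augs l ≫ H0smap f l = f ≫ y.augs l := by
  induction l with
  | nil => exact (Category.id_comp _).trans (Category.comp_id _).symm
  | cons k ks ih =>
    show (x.augs ks ≫ (x.H0s ks).aug k) ≫ H0map (H0smap f ks) k = f ≫ y.augs ks ≫ (y.H0s ks).aug k
    rw [Category.assoc, aug_nat, reassoc_of% ih]

/-- vertices of the restriction -/
def E (x : Cube 𝒜 ι) (U V T : Finset ι) : (x.res U V).vtx T ≅ x.vtx ((T ∩ U) ∪ V) := Iso.refl _

lemma res_mapLE_aux {U V : Finset ι} {T T' : Finset ι} (h : T' ⊆ T) :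
    (T' ∩ U) ∪ V ⊆ (T ∩ U) ∪ V :=
  Finset.union_subset_union (Finset.inter_subset_inter h (subset_refl U)) (subset_refl V)

lemma res_mapLE (x : Cube 𝒜 ι) (U V : Finset ι) {T T' : Finset ι} (h : T' ⊆ T) :
    (x.res U V).mapLE h = (x.E U V T).hom ≫ x.mapLE (res_mapLE_aux h) ≫ (x.E U V T').inv :=
  ((Category.id_comp _).trans (Category.comp_id _)).symm

/-- functoriality of restriction -/
def resmap {x y : Cube 𝒜 ι} (f : x ⟶ y) (U V : Finset ι) : x.res U V ⟶ y.res U V :=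
  mkHom (fun T => (x.E U V T).hom ≫ cmp f ((T ∩ U) ∪ V) ≫ (y.E U V T).inv) (by
    intro T T' h
    simp [res_mapLE, mapLE_cmp_assoc])

lemma cmp_resmap {x y : Cube 𝒜 ι} (f : x ⟶ y) (U V T : Finset ι) :
    cmp (resmap f U V) T = (x.E U V T).hom ≫ cmp f ((T ∩ U) ∪ V) ≫ (y.E U V T).inv := rfl

lemma resmap_comp {x y z : Cube 𝒜 ι} (f : x ⟶ y) (g : y ⟶ z) (U V : Finset ι) :
    resmap (f ≫ g) U V = resmap f U V ≫ resmap g U V := by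
  apply hom_ext'
  intro T
  simp [cmp_comp, cmp_resmap]

lemma tau_aux {U V V' : Finset ι} (T : Finset ι) (h : V' ⊆ V) : (T ∩ U) ∪ V' ⊆ (T ∩ U) ∪ V :=
  Finset.union_subset_union (subset_refl _) h

/-- comparison of restrictions -/
def tau (x : Cube 𝒜 ι) (U : Finset ι) {V V' : Finset ι} (h : V' ⊆ V) :
    x.res U V ⟶ x.res U V' :=
  mkHom (fun T => (x.E U V T).hom ≫ x.mapLE (tau_aux T h) ≫ (x.E U V' T).inv) (by
    intro T T' h'
    simp [res_mapLE, mapLE_mapLE_assoc])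

lemma cmp_tau (x : Cube 𝒜 ι) (U : Finset ι) {V V' : Finset ι} (h : V' ⊆ V) (T : Finset ι) :
    cmp (x.tau U h) T = (x.E U V T).hom ≫ x.mapLE (tau_aux T h) ≫ (x.E U V' T).inv := rfl

lemma set_aux1 {U V : Finset ι} {k : ι} (hU : k ∈ U) (T : Finset ι) :
    insert k ((T ∩ U) ∪ V) = ((insert k T) ∩ U) ∪ V := by
  ext a; by_cases h : a = k <;> simp [h, hU]

lemma set_aux2 {U V : Finset ι} {k : ι} (hV : k ∉ V) (T : Finset ι) :
    (insert k ((T ∩ U) ∪ V)).erase k = (((insert k T).erase k) ∩ U) ∪ V := by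
  ext a; by_cases h : a = k <;> simp [h, hV]

lemma bd_res (x : Cube 𝒜 ι) {U V : Finset ι} {k : ι} (hU : k ∈ U) (hV : k ∉ V) (T : Finset ι) :
    (x.res U V).bd (insert k T) k = (x.E U V _).hom ≫ x.mapLE (set_aux1 hU T).le ≫
      x.bd (insert k ((T ∩ U) ∪ V)) k ≫ x.mapLE (set_aux2 hV T).ge ≫ (x.E U V _).inv := by
  simp [bd, res_mapLE, mapLE_mapLE_assoc]

lemma res_bd (x : Cube 𝒜 ι) {U V : Finset ι} {k : ι} (hU : k ∈ U) (hV : k ∉ V) (T : Finset ι) :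
    x.bd (insert k ((T ∩ U) ∪ V)) k = x.mapLE (set_aux1 hU T).ge ≫ (x.E U V _).inv ≫ 
      (x.res U V).bd (insert k T) k ≫ (x.E U V _).hom ≫ x.mapLE (set_aux2 hV T).le := by
  simp [bd, res_mapLE, mapLE_mapLE_assoc, mapLE_mapLE]

/-- `H0` commutes with restriction -/
noncomputable def resIso (x : Cube 𝒜 ι) {U V : Finset ι} {k : ι} (hU : k ∈ U) (hV : k ∉ V) :
    (x.res U V).H0 k ≅ (x.H0 k).res U V where
  hom := mkHom (fun T => (x.res U V).H0desc k T ((x.E U V _).hom ≫ x.mapLE (set_aux2 hV T).le ≫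
      x.H0π k ((T ∩ U) ∪ V) ≫ ((x.H0 k).E U V T).inv) (by
        simp [bd_res x hU hV, mapLE_mapLE_assoc, mapLE_refl, bd_H0π_assoc])) (by
    intro T T' h
    rw [← cancel_epi ((x.res U V).H0π k T), H0π_mapLE_assoc, H0π_desc, H0π_desc_assoc]
    simp [res_mapLE, H0π_mapLE_assoc, mapLE_mapLE_assoc])
  inv := mkHom (fun T => ((x.H0 k).E U V T).hom ≫ x.H0desc k ((T ∩ U) ∪ V)
      (x.mapLE (set_aux2 hV T).ge ≫ (x.E U V _).inv ≫ (x.res U V).H0π k T) (by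
        simp [res_bd x hU hV, mapLE_mapLE_assoc, mapLE_refl, bd_H0π])) (by
    intro T T' h
    rw [← cancel_epi ((x.H0 k).E U V T).inv, ← cancel_epi (x.H0π k ((T ∩ U) ∪ V))]
    simp [res_mapLE, H0π_mapLE_assoc, H0π_mapLE, H0π_desc, H0π_desc_assoc, mapLE_mapLE_assoc])
  hom_inv_id := by
    apply hom_ext'
    intro T
    rw [← cancel_epi ((x.res U V).H0π k T), cmp_comp, cmp_mkHom, cmp_mkHom, H0π_desc_assoc, cmp_id]
    simp [H0π_desc, mapLE_mapLE_assoc, mapLE_refl]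
  inv_hom_id := by
    apply hom_ext'
    intro T
    rw [← cancel_epi ((x.H0 k).E U V T).inv, ← cancel_epi (x.H0π k ((T ∩ U) ∪ V)),
      cmp_comp, cmp_mkHom, cmp_mkHom, cmp_id]
    simp [H0π_desc, H0π_desc_assoc, mapLE_mapLE_assoc, mapLE_refl]

lemma H0π_resIso (x : Cube 𝒜 ι) {U V : Finset ι} {k : ι} (hU : k ∈ U) (hV : k ∉ V)
    (T : Finset ι) : (x.res U V).H0π k T ≫ cmp (x.resIso hU hV).hom T =
      (x.E U V _).hom ≫ x.mapLE (set_aux2 hV T).le ≫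
      x.H0π k ((T ∩ U) ∪ V) ≫ ((x.H0 k).E U V T).inv := H0π_desc _ _ _ _ _

lemma aug_resIso (x : Cube 𝒜 ι) {U V : Finset ι} {k : ι} (hU : k ∈ U) (hV : k ∉ V) :
    (x.res U V).aug k ≫ (x.resIso hU hV).hom = resmap (x.aug k) U V := by
  apply hom_ext'
  intro T
  have h : ∀ T : Finset ι, (insert k T).erase k ⊆ T := by intro T a; simp
  rw [cmp_comp, cmp_aug _ _ _ (h _), cmp_resmap, cmp_aug _ _ _ (h _), Category.assoc, H0π_resIso]
  simp [res_mapLE, mapLE_mapLE_assoc]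

lemma tau_resIso (x : Cube 𝒜 ι) {U V V' : Finset ι} (h : V' ⊆ V) {k : ι} (hU : k ∈ U)
    (hV : k ∉ V) (hV' : k ∉ V') :
    H0map (x.tau U h) k ≫ (x.resIso hU hV').hom = (x.resIso hU hV).hom ≫ (x.H0 k).tau U h := by
  apply hom_ext'
  intro T
  rw [← cancel_epi ((x.res U V).H0π k T), cmp_comp, cmp_comp, H0π_H0map_assoc, H0π_resIso,
    reassoc_of% (H0π_resIso x hU hV T), cmp_tau, cmp_tau]
  simp [H0π_mapLE_assoc, mapLE_mapLE_assoc]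

/-- iterated -/
noncomputable def ressIso (x : Cube 𝒜 ι) (U V : Finset ι) : ∀ (l : List ι)
    (_ : ∀ k ∈ l, k ∈ U ∧ k ∉ V), (x.res U V).H0s l ≅ (x.H0s l).res U V
  | [], _ => Iso.refl _
  | k :: ks, h => H0iso (ressIso x U V ks (fun j hj => h j (List.mem_cons_of_mem _ hj))) k ≪≫
      (x.H0s ks).resIso (h k (by simp)).1 (h k (by simp)).2

lemma augs_ressIso (x : Cube 𝒜 ι) (U V : Finset ι) : ∀ (l : List ι)
    (h : ∀ k ∈ l, k ∈ U ∧ k ∉ V), 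
    (x.res U V).augs l ≫ (x.ressIso U V l h).hom = resmap (x.augs l) U V
  | [], _ => by
    apply hom_ext'
    intro T
    show cmp (𝟙 (x.res U V) ≫ 𝟙 (x.res U V)) T = (x.E U V T).hom ≫ cmp (𝟙 x) _ ≫ (x.E U V T).inv
    rw [cmp_id, Category.id_comp, Category.id_comp, Iso.hom_inv_id, cmp_id]
  | k :: ks, h => by
    have ih := augs_ressIso x U V ks (fun j hj => h j (List.mem_cons_of_mem _ hj))
    show ((x.res U V).augs ks ≫ aug _ k) ≫ H0map (ressIso x U V ks _).hom k ≫
      (resIso _ _ _).hom = resmap (x.augs ks ≫ aug _ k) U V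
    rw [resmap_comp, ← ih, Category.assoc, reassoc_of% (aug_nat), aug_resIso, Category.assoc]

lemma tau_ressIso (x : Cube 𝒜 ι) (U : Finset ι) {V V' : Finset ι} (h : V' ⊆ V) : ∀ (l : List ι)
    (h1 : ∀ k ∈ l, k ∈ U ∧ k ∉ V) (h2 : ∀ k ∈ l, k ∈ U ∧ k ∉ V'),
    H0smap (x.tau U h) l ≫ (x.ressIso U V' l h2).hom =
      (x.ressIso U V l h1).hom ≫ (x.H0s l).tau U h
  | [], _, _ => by
    exact (Category.comp_id _).trans (Category.id_comp _).symm
  | k :: ks, h1, h2 => by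
    have ih := tau_ressIso x U h ks (fun j hj => h1 j (List.mem_cons_of_mem _ hj))
      (fun j hj => h2 j (List.mem_cons_of_mem _ hj))
    show H0map (H0smap (x.tau U h) ks) k ≫ H0map (ressIso x U V' ks _).hom k ≫
      (resIso _ _ _).hom = (H0map (ressIso x U V ks _).hom k ≫
      (resIso _ _ _).hom) ≫ _
    rw [← Category.assoc, ← H0map_comp, ih, H0map_comp, Category.assoc,
      tau_resIso _ _ _ (h1 k (by simp)).2]
    exact (Category.assoc _ _ _).symm

end Functoriality

end Cube

namespace Cube

section Signs

variable {ι : Type w} [LinearOrder ι]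

/-- the sign -/
def sgn (T : Finset ι) (j : ι) : ℤ := (-1 : ℤ) ^ (T.filter (fun t => j < t)).card

lemma sgn_mul_self (T : Finset ι) (j : ι) : sgn T j * sgn T j = 1 := by
  unfold sgn; rw [← mul_pow]; simp

lemma sgn_insert {T : Finset ι} {k : ι} (hk : k ∉ T) (j : ι) :
    sgn (insert k T) j = sgn T j * (if j < k then -1 else 1) := by
  unfold sgn
  rw [Finset.filter_insert]
  split_ifs with h
  · rw [Finset.card_insert_of_notMem (by simp [hk]), pow_succ]
  · simp

lemma sgn_key1 {T : Finset ι} {k : ι} (hk : k ∉ T) : sgn T k * sgn (insert k T) k = 1 := by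
  rw [sgn_insert hk]; simp [sgn_mul_self]

lemma sgn_key2 {T : Finset ι} {k j : ι} (hk : k ∉ T) (hj : j ∈ T) :
    sgn T k * sgn (insert k T) j = - (sgn T j * sgn (T.erase j) k) := by
  have h1 : sgn T k = sgn (T.erase j) k * (if k < j then -1 else 1) := by
    rw [← sgn_insert (Finset.notMem_erase j T), Finset.insert_erase hj]
  have hne : k ≠ j := by rintro rfl; exact hk hj
  rw [sgn_insert hk, h1]
  rcases lt_or_gt_of_ne hne with h | h
  · simp [h, h.not_gt]; ring
  · simp [h, h.not_gt]; ring

lemma sum_aux {M : Type*} [AddCommMonoid M] {W T : Finset ι} {k : ι} (hW : W = insert k T)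
    (hk : k ∉ T) (F : ι → M) : ∑ j ∈ W, F j = F k + ∑ j ∈ T, F j := by
  subst hW; exact Finset.sum_insert hk

end Signs

section Tot

variable {𝒜 : Type u} [Category.{v} 𝒜] [Abelian 𝒜] {ι : Type w} [LinearOrder ι]

/-- inclusion of a vertex -/
noncomputable def in0 (x : Cube 𝒜 ι) (S : Finset ι) (n : ℕ)
    (T : {T : Finset ι // T ∈ Finset.powersetCard n S}) : x.vtx T.1 ⟶ x.totObj S n :=
  biproduct.ι (fun T : {T : Finset ι // T ∈ Finset.powersetCard n S} => x.vtx T.1) T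

/-- projection to a vertex -/
noncomputable def pr0 (x : Cube 𝒜 ι) (S : Finset ι) (n : ℕ)
    (T : {T : Finset ι // T ∈ Finset.powersetCard n S}) : x.totObj S n ⟶ x.vtx T.1 :=
  biproduct.π (fun T : {T : Finset ι // T ∈ Finset.powersetCard n S} => x.vtx T.1) T

/-- inclusion of a vertex -/
noncomputable def inT (x : Cube 𝒜 ι) (S : Finset ι) (n : ℕ) (T : Finset ι) :
    x.vtx T ⟶ x.totObj S n :=
  if h : T ∈ Finset.powersetCard n S then x.in0 S n ⟨T, h⟩ else 0

lemma inT_eq (x : Cube 𝒜 ι) (S : Finset ι) (n : ℕ) {T : Finset ι}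
    (h : T ∈ Finset.powersetCard n S) : x.inT S n T = x.in0 S n ⟨T, h⟩ := by
  rw [inT, dif_pos h]

/-- maps out of `totObj` -/
noncomputable def tdesc (x : Cube 𝒜 ι) (S : Finset ι) (n : ℕ) {Z : 𝒜}
    (g : ∀ T, x.vtx T ⟶ Z) : x.totObj S n ⟶ Z :=
  biproduct.desc fun T : {T : Finset ι // T ∈ Finset.powersetCard n S} => g T.1

lemma inT_tdesc (x : Cube 𝒜 ι) (S : Finset ι) (n : ℕ) {Z : 𝒜}
    (g : ∀ T, x.vtx T ⟶ Z) {T : Finset ι} (h : T ⊆ S) (hc : T.card = n) :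
    x.inT S n T ≫ x.tdesc S n g = g T := by
  have hm : T ∈ Finset.powersetCard n S := Finset.mem_powersetCard.2 ⟨h, hc⟩
  rw [inT_eq _ _ _ hm]
  exact biproduct.ι_desc _ _

lemma tot_hom_ext (x : Cube 𝒜 ι) (S : Finset ι) (n : ℕ) {Z : 𝒜} {f g : x.totObj S n ⟶ Z}
    (h : ∀ T ⊆ S, T.card = n → x.inT S n T ≫ f = x.inT S n T ≫ g) : f = g := by
  apply biproduct.hom_ext'
  rintro ⟨T, hT⟩
  have := h T (Finset.mem_powersetCard.1 hT).1 (Finset.mem_powersetCard.1 hT).2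
  rw [inT_eq _ _ _ hT] at this
  exact this

lemma inT_π (x : Cube 𝒜 ι) (S : Finset ι) (n : ℕ) {T : Finset ι} (h : T ⊆ S) (hc : T.card = n)
    (T' : {T : Finset ι // T ∈ Finset.powersetCard n S}) :
    x.inT S n T ≫ x.pr0 S n T'
      = if h : T'.1 = T then eqToHom (congrArg x.vtx h.symm) else 0 := by
  have hm : T ∈ Finset.powersetCard n S := Finset.mem_powersetCard.2 ⟨h, hc⟩
  rw [inT_eq _ _ _ hm]
  split_ifs with h1
  · obtain ⟨T', h'⟩ := T'
    dsimp at h1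
    subst h1
    exact biproduct.ι_π_self _ _
  · exact biproduct.ι_π_ne _ (fun h2 => h1 (by rw [← h2]))

lemma inT_totD (x : Cube 𝒜 ι) (S : Finset ι) (n : ℕ) {T : Finset ι} (h : T ⊆ S)
    (hc : T.card = n + 1) :
    x.inT S (n+1) T ≫ x.totD S n = ∑ j ∈ T, sgn T j • (x.bd T j ≫ x.inT S n (T.erase j)) := by
  have hm : T ∈ Finset.powersetCard (n+1) S := Finset.mem_powersetCard.2 ⟨h, hc⟩
  apply biproduct.hom_ext
  intro T'
  change (x.inT S (n+1) T ≫ x.totD S n) ≫ x.pr0 S n T' =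
    (∑ j ∈ T, sgn T j • (x.bd T j ≫ x.inT S n (T.erase j))) ≫ x.pr0 S n T'
  rw [Preadditive.sum_comp]
  rw [inT_eq _ _ _ hm]
  unfold totD
  refine ((Category.assoc _ _ _).trans ((biproduct.ι_desc_assoc _ _ _).trans
    (biproduct.lift_π _ _))).trans ?_
  refine Finset.sum_congr rfl fun j hj => ?_
  rw [Preadditive.zsmul_comp, Category.assoc, inT_π _ _ _ ((Finset.erase_subset _ _).trans h)
    (by rw [Finset.card_erase_of_mem hj, hc]; rfl)]
  split_ifs with h1
  · rfl
  · simp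

lemma inT_totD_assoc (x : Cube 𝒜 ι) (S : Finset ι) (n : ℕ) {T : Finset ι} (h : T ⊆ S)
    (hc : T.card = n + 1)
    {Z' : 𝒜} (h' : x.totObj S n ⟶ Z') : x.inT S (n+1) T ≫ x.totD S n ≫ h' =
      (∑ j ∈ T, sgn T j • (x.bd T j ≫ x.inT S n (T.erase j))) ≫ h' := by
  rw [← Category.assoc, inT_totD x S n h hc]

lemma mapLE_inT (x : Cube 𝒜 ι) (S : Finset ι) (n : ℕ) {W T T' : Finset ι} (h : T ⊆ W)
    (h' : T' ⊆ W) (e : T = T') : x.mapLE h ≫ x.inT S n T = x.mapLE h' ≫ x.inT S n T' := by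
  subst e; rfl

lemma mapLE_inT' (x : Cube 𝒜 ι) (S : Finset ι) (n : ℕ) {T T' : Finset ι} (h : T ⊆ T')
    (e : T = T') : x.mapLE h ≫ x.inT S n T = x.inT S n T' := by
  subst e; rw [mapLE_refl, Category.id_comp]

lemma U_aux1 {S : Finset ι} {k : ι} {T : Finset ι} (hT : T ⊆ S.erase k) :
    (T ∩ S.erase k) ∪ {k} = insert k T := by
  rw [Finset.inter_eq_left.2 hT, Finset.union_comm]; rfl

lemma U_aux2 {S : Finset ι} {k : ι} {T : Finset ι} (hT : T ⊆ S.erase k) :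
    (T ∩ S.erase k) ∪ ∅ = T := by
  rw [Finset.inter_eq_left.2 hT, Finset.union_empty]

lemma U_aux3 {S : Finset ι} {k : ι} {T : Finset ι} (hk : k ∈ T) :
    (T.erase k ∩ S.erase k) ∪ {k} ⊆ T := by
  intro a
  simp only [Finset.mem_union, Finset.mem_inter, Finset.mem_erase, Finset.mem_singleton]
  rintro (h | h)
  · exact h.1.2
  · rwa [h]

lemma U_aux4 {S : Finset ι} {k : ι} {T : Finset ι} :
    (T ∩ S.erase k) ∪ ∅ ⊆ T := by
  rw [Finset.union_empty]; exact Finset.inter_subset_left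

lemma U_notMem {S : Finset ι} {k : ι} {T : Finset ι} (hT : T ⊆ S.erase k) : k ∉ T :=
  fun h => Finset.notMem_erase k S (hT h)

/-- functoriality of tot -/
noncomputable def totMap {x y : Cube 𝒜 ι} (f : x ⟶ y) (S : Finset ι) (n : ℕ) :
    x.totObj S n ⟶ y.totObj S n := x.tdesc S n fun T => cmp f T ≫ y.inT S n T

lemma inT_totMap {x y : Cube 𝒜 ι} (f : x ⟶ y) (S : Finset ι) (n : ℕ) {T : Finset ι} (h : T ⊆ S)
    (hc : T.card = n) : x.inT S n T ≫ totMap f S n = cmp f T ≫ y.inT S n T :=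
  inT_tdesc _ _ _ _ h hc

lemma inT_totMap_assoc {x y : Cube 𝒜 ι} (f : x ⟶ y) (S : Finset ι) (n : ℕ) {T : Finset ι} (h : T ⊆ S)
    (hc : T.card = n)
    {Z' : 𝒜} (h' : y.totObj S n ⟶ Z') : x.inT S n T ≫ totMap f S n ≫ h' =
      cmp f T ≫ y.inT S n T ≫ h' := by
  rw [← Category.assoc, inT_totMap f S n h hc, Category.assoc]

lemma totMap_comm {x y : Cube 𝒜 ι} (f : x ⟶ y) (S : Finset ι) (n : ℕ) :
    totMap f S (n+1) ≫ y.totD S n = x.totD S n ≫ totMap f S n := by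
  apply tot_hom_ext
  intro T hT hc
  rw [inT_totMap_assoc _ _ _ hT hc, inT_totD _ _ _ hT hc, inT_totD_assoc _ _ _ hT hc,
    Preadditive.comp_sum, Preadditive.sum_comp]
  refine Finset.sum_congr rfl fun j hj => ?_
  rw [Preadditive.comp_zsmul, Preadditive.zsmul_comp, Category.assoc,
    inT_totMap _ _ _ ((Finset.erase_subset _ _).trans hT)
    (by rw [Finset.card_erase_of_mem hj, hc]; rfl), bd_cmp_assoc]

variable (x : Cube 𝒜 ι) (S : Finset ι) (k : ι)

/-- cone inclusion -/
noncomputable def cInl (n : ℕ) :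
    (x.res (S.erase k) {k}).totObj (S.erase k) n ⟶ x.totObj S (n+1) :=
  tdesc _ _ _ fun T => sgn T k • ((x.E _ _ T).hom ≫ x.inT S (n+1) ((T ∩ S.erase k) ∪ {k}))

/-- cone inclusion -/
noncomputable def cInr (n : ℕ) :
    (x.res (S.erase k) ∅).totObj (S.erase k) n ⟶ x.totObj S n :=
  tdesc _ _ _ fun T => (x.E _ _ T).hom ≫ x.inT S n ((T ∩ S.erase k) ∪ ∅)

/-- cone projection -/
noncomputable def cFst (n : ℕ) :
    x.totObj S (n+1) ⟶ (x.res (S.erase k) {k}).totObj (S.erase k) n :=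
  tdesc _ _ _ fun T => if h : k ∈ T then
    sgn (T.erase k) k • (x.mapLE (U_aux3 h) ≫ (x.E _ _ (T.erase k)).inv ≫ inT _ _ n (T.erase k))
  else 0

/-- cone projection -/
noncomputable def cSnd (n : ℕ) :
    x.totObj S n ⟶ (x.res (S.erase k) ∅).totObj (S.erase k) n :=
  tdesc _ _ _ fun T => if k ∈ T then 0 else
    x.mapLE U_aux4 ≫ (x.E _ _ T).inv ≫ inT _ _ n T

variable {S k}

lemma inT_cInl (n : ℕ) {T : Finset ι} (hT : T ⊆ S.erase k) (hc : T.card = n) :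
    inT _ _ n T ≫ x.cInl S k n =
      sgn T k • ((x.E _ _ T).hom ≫ x.mapLE (U_aux1 hT).ge ≫ x.inT S (n+1) (insert k T)) := by
  rw [cInl, inT_tdesc _ _ _ _ hT hc, mapLE_inT' _ _ _ _ (U_aux1 hT).symm]

lemma inT_cInr (n : ℕ) {T : Finset ι} (hT : T ⊆ S.erase k) (hc : T.card = n) :
    inT _ _ n T ≫ x.cInr S k n =
      (x.E _ _ T).hom ≫ x.mapLE (U_aux2 hT).ge ≫ x.inT S n T := by
  rw [cInr, inT_tdesc _ _ _ _ hT hc, mapLE_inT' _ _ _ _ (U_aux2 hT).symm]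

lemma inT_cFst (n : ℕ) {T : Finset ι} (hT : T ⊆ S) (hc : T.card = n + 1) (h : k ∈ T) :
    x.inT S (n+1) T ≫ x.cFst S k n =
    sgn (T.erase k) k • (x.mapLE (U_aux3 h) ≫ (x.E _ _ (T.erase k)).inv ≫ inT _ _ n (T.erase k)) := by
  rw [cFst, inT_tdesc _ _ _ _ hT hc, dif_pos h]

lemma inT_cFst' (n : ℕ) {T : Finset ι} (hT : T ⊆ S) (hc : T.card = n + 1) (h : k ∉ T) :
    x.inT S (n+1) T ≫ x.cFst S k n = 0 := by
  rw [cFst, inT_tdesc _ _ _ _ hT hc, dif_neg h]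

lemma inT_cSnd (n : ℕ) {T : Finset ι} (hT : T ⊆ S) (hc : T.card = n) (h : k ∉ T) :
    x.inT S n T ≫ x.cSnd S k n = x.mapLE U_aux4 ≫ (x.E _ _ T).inv ≫ inT _ _ n T := by
  rw [cSnd, inT_tdesc _ _ _ _ hT hc, if_neg h]

lemma inT_cSnd' (n : ℕ) {T : Finset ι} (hT : T ⊆ S) (hc : T.card = n) (h : k ∈ T) :
    x.inT S n T ≫ x.cSnd S k n = 0 := by
  rw [cSnd, inT_tdesc _ _ _ _ hT hc, if_pos h]

lemma ins_sub (hk : k ∈ S) {T : Finset ι} (hT : T ⊆ S.erase k) : insert k T ⊆ S :=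
  Finset.insert_subset hk (hT.trans (Finset.erase_subset _ _))

lemma ins_card {n : ℕ} {T : Finset ι} (hT : T ⊆ S.erase k) (hc : T.card = n) :
    (insert k T).card = n + 1 := by
  rw [Finset.card_insert_of_notMem (U_notMem hT), hc]

lemma sub_U {T : Finset ι} (hT : T ⊆ S) (h : k ∉ T) : T ⊆ S.erase k :=
  Finset.subset_erase.2 ⟨hT, h⟩

lemma E_mapLE_inT {V : Finset ι} {n : ℕ} {W T T' : Finset ι} {U : Finset ι} (e : T = T')
    (h : (T ∩ U) ∪ V ⊆ W) (h' : (T' ∩ U) ∪ V ⊆ W) :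
    x.mapLE h ≫ (x.E U V T).inv ≫ inT _ S n T = x.mapLE h' ≫ (x.E U V T').inv ≫ inT _ S n T' := by
  subst e; rfl

/-- The cone decomposition of `Tot`. -/
noncomputable def cone (hk : k ∈ S) : ConeData
    (fun n => (x.res (S.erase k) {k}).totObj (S.erase k) n)
    (fun n => (x.res (S.erase k) {k}).totD (S.erase k) n)
    (fun n => (x.res (S.erase k) ∅).totObj (S.erase k) n)
    (fun n => (x.res (S.erase k) ∅).totD (S.erase k) n)
    (fun n => x.totObj S n) (fun n => x.totD S n)
    (fun n => totMap (x.tau (S.erase k) (Finset.empty_subset {k})) (S.erase k) n) where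
  inl := x.cInl S k
  inr := x.cInr S k
  fst := x.cFst S k
  snd := x.cSnd S k
  inl_fst n := by
    apply tot_hom_ext
    intro T hT hc
    have e : (insert k T).erase k = T := Finset.erase_insert (U_notMem hT)
    rw [← Category.assoc, inT_cInl _ _ hT hc, Preadditive.zsmul_comp, Category.assoc,
      Category.assoc, inT_cFst x n (ins_sub hk hT) (ins_card hT hc) (by simp),
      Preadditive.comp_zsmul, Preadditive.comp_zsmul, smul_smul,
      show sgn ((insert k T).erase k) k = sgn T k by rw [e], sgn_mul_self, one_smul,
      mapLE_mapLE_assoc, x.E_mapLE_inT e _ (subset_refl _), mapLE_refl, Category.id_comp,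
      Iso.hom_inv_id_assoc, Category.comp_id]
  inr_snd n := by
    apply tot_hom_ext
    intro T hT hc
    rw [← Category.assoc, inT_cInr _ _ hT hc, Category.assoc,
      Category.assoc, inT_cSnd x n (hT.trans (Finset.erase_subset _ _)) hc (U_notMem hT),
      mapLE_mapLE_assoc, mapLE_refl, Category.id_comp,
      Iso.hom_inv_id_assoc, Category.comp_id]
  inr_fst n := by
    apply tot_hom_ext
    intro T hT hc
    rw [← Category.assoc, inT_cInr _ _ hT hc, Category.assoc,
      Category.assoc, inT_cFst' x n (hT.trans (Finset.erase_subset _ _)) hc (U_notMem hT)]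
    simp
  inl_snd n := by
    apply tot_hom_ext
    intro T hT hc
    rw [← Category.assoc, inT_cInl _ _ hT hc, Preadditive.zsmul_comp, Category.assoc,
      Category.assoc, inT_cSnd' x _ (ins_sub hk hT) (ins_card hT hc) (by simp)]
    simp
  tot n := by
    apply tot_hom_ext
    intro T hT hc
    rw [Preadditive.comp_add, Category.comp_id, ← Category.assoc, ← Category.assoc]
    by_cases h : k ∈ T
    · have hT' : T.erase k ⊆ S.erase k := Finset.erase_subset_erase _ hT
      rw [inT_cSnd' x _ hT hc h, zero_comp, add_zero, inT_cFst x n hT hc h,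
        Preadditive.zsmul_comp, Category.assoc, Category.assoc, inT_cInl _ _ hT' (by
          rw [Finset.card_erase_of_mem h, hc]; rfl), Preadditive.comp_zsmul,
        Preadditive.comp_zsmul, smul_smul, sgn_mul_self, one_smul, Iso.inv_hom_id_assoc,
        mapLE_mapLE_assoc, mapLE_inT' _ _ _ _ (Finset.insert_erase h)]
    · rw [inT_cFst' x _ hT hc h, zero_comp, zero_add, inT_cSnd x _ hT hc h, Category.assoc,
        Category.assoc, inT_cInr _ _ (sub_U hT h) hc, Iso.inv_hom_id_assoc, mapLE_mapLE_assoc,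
        mapLE_inT' _ _ _ _ rfl]
  tot0 := by
    apply tot_hom_ext
    intro T hT hc
    have h : k ∉ T := by rw [Finset.card_eq_zero.1 hc]; simp
    rw [Category.comp_id, ← Category.assoc, inT_cSnd x _ hT hc h, Category.assoc,
        Category.assoc, inT_cInr _ _ (sub_U hT h) hc, Iso.inv_hom_id_assoc, mapLE_mapLE_assoc,
        mapLE_inT' _ _ _ _ rfl]
  f_comm n := totMap_comm _ _ _
  inr_d n := by
    apply tot_hom_ext
    intro T hT hc
    rw [← Category.assoc, inT_cInr _ _ hT hc, Category.assoc,
      Category.assoc, inT_totD x _ _ (hT.trans (Finset.erase_subset _ _)) hc,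
      inT_totD_assoc _ _ _ hT hc, Preadditive.comp_sum, Preadditive.comp_sum,
      Preadditive.sum_comp]
    refine Finset.sum_congr rfl fun j hj => ?_
    rw [Preadditive.zsmul_comp, Category.assoc, inT_cInr _ _ ((Finset.erase_subset _ _).trans hT)
      (by rw [Finset.card_erase_of_mem hj, hc]; rfl), bd, bd, res_mapLE, Preadditive.comp_zsmul,
      Preadditive.comp_zsmul]
    simp [mapLE_mapLE_assoc]
  inl_d n := by
    apply tot_hom_ext
    intro T hT hc
    have hkT := U_notMem hT
    rw [← Category.assoc, inT_cInl _ _ hT hc, Preadditive.zsmul_comp, Category.assoc,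
      Category.assoc, inT_totD x _ _ (ins_sub hk hT) (ins_card hT hc), sum_aux rfl hkT,
      Preadditive.comp_add, Preadditive.comp_add, smul_add, Preadditive.comp_add]
    refine (add_comm _ _).trans ?_
    congr 1
    · rw [Preadditive.comp_neg, inT_totD_assoc _ _ _ hT hc,
        Preadditive.comp_sum, Preadditive.comp_sum, Preadditive.sum_comp, Finset.smul_sum,
        ← Finset.sum_neg_distrib]
      refine Finset.sum_congr rfl fun j hj => ?_
      have hne : k ≠ j := by rintro rfl; exact hkT hj
      rw [Preadditive.comp_zsmul, Preadditive.comp_zsmul, smul_smul, sgn_key2 hkT hj,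
        Preadditive.zsmul_comp, Category.assoc, inT_cInl _ _ ((Finset.erase_subset _ _).trans hT)
        (by rw [Finset.card_erase_of_mem hj, hc]; rfl), bd, bd, res_mapLE, Preadditive.comp_zsmul,
        smul_smul, neg_smul]
      simp only [Category.assoc, Iso.inv_hom_id_assoc, mapLE_mapLE_assoc]
      rw [mapLE_inT _ _ _ _ _ (Finset.erase_insert_of_ne hne)]
    · rw [Preadditive.comp_zsmul, Preadditive.comp_zsmul, smul_smul, sgn_key1 hkT, one_smul,
        inT_totMap_assoc _ _ _ hT hc, inT_cInr _ _ hT hc, cmp_tau, bd]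
      simp only [Category.assoc, Iso.inv_hom_id_assoc, mapLE_mapLE_assoc]
      rw [mapLE_inT _ _ _ _ _ (Finset.erase_insert hkT)]
  inl_d0 := by
    apply tot_hom_ext
    intro T hT hc
    have hkT := U_notMem hT
    have hT0 := Finset.card_eq_zero.1 hc
    rw [← Category.assoc, inT_cInl _ _ hT hc, Preadditive.zsmul_comp, Category.assoc,
      Category.assoc, inT_totD x _ _ (ins_sub hk hT) (ins_card hT hc), sum_aux rfl hkT,
      Finset.sum_eq_zero (s := T) (by simp [hT0]), add_zero]
    rw [Preadditive.comp_zsmul, Preadditive.comp_zsmul, smul_smul, sgn_key1 hkT, one_smul,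
        inT_totMap_assoc _ _ _ hT hc, inT_cInr _ _ hT hc, cmp_tau, bd]
    simp only [Category.assoc, Iso.inv_hom_id_assoc, mapLE_mapLE_assoc]
    rw [mapLE_inT _ _ _ _ _ (Finset.erase_insert hkT)]

end Tot

end Cube

namespace Cube

section Final

variable {𝒜 : Type u} [Category.{v} 𝒜] [Abelian 𝒜] {ι : Type w} [LinearOrder ι]

lemma totD_comp_aux (m : ℕ) : ∀ (S : Finset ι), S.card = m → ∀ (x : Cube 𝒜 ι) (n : ℕ),
    x.totD S (n+1) ≫ x.totD S n = 0 := by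
  induction m with
  | zero =>
    intro S hS x n
    apply tot_hom_ext
    intro T hT hc
    have := Finset.card_le_card hT
    omega
  | succ m ih =>
    intro S hS x n
    obtain ⟨k, hk⟩ : S.Nonempty := Finset.card_pos.1 (by omega)
    have hc : (S.erase k).card = m := by rw [Finset.card_erase_of_mem hk]; omega
    exact (x.cone hk).d_comp (ih _ hc _) (ih _ hc _) n

lemma totD_comp (x : Cube 𝒜 ι) (S : Finset ι) (n : ℕ) : x.totD S (n+1) ≫ x.totD S n = 0 :=
  totD_comp_aux _ S rfl x n

/-- vertex isomorphism -/
def cmpIso {x y : Cube 𝒜 ι} (e : x ≅ y) (T : Finset ι) : x.vtx T ≅ y.vtx T where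
  hom := cmp e.hom T
  inv := cmp e.inv T
  hom_inv_id := by rw [← cmp_comp, e.hom_inv_id, cmp_id]
  inv_hom_id := by rw [← cmp_comp, e.inv_hom_id, cmp_id]

lemma cmpIso_hom {x y : Cube 𝒜 ι} (e : x ≅ y) (T : Finset ι) :
    (cmpIso e T).hom = cmp e.hom T := rfl

lemma isoLE_hom (x : Cube 𝒜 ι) {T U : Finset ι} (h : T = U) :
    (x.isoLE h).hom = x.mapLE h.ge := rfl

lemma mono_of_square {A B C D : 𝒜} {f : A ⟶ B} {g : C ⟶ D} (a : A ≅ C) (b : B ⟶ D) [Mono b]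
    (h : f ≫ b = a.hom ≫ g) [Mono f] (hb : IsIso b) : Mono g := by
  have : g = a.inv ≫ f ≫ b := by rw [h]; simp
  rw [this]
  infer_instance

lemma mono_bd_iff (x : Cube 𝒜 ι) {T T' : Finset ι} (h : T = T') (k : ι) (hm : Mono (x.bd T k)) :
    Mono (x.bd T' k) := by
  subst h; exact hm

lemma Admissible.mono {x : Cube 𝒜 ι} {S : Finset ι} (h : x.Admissible S) {T : Finset ι}
    (hT : T ⊆ S) {k : ι} (hk : k ∈ T) : Mono (x.bd T k) := by
  rw [Admissible] at h
  exact h.1 T hT k hk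

lemma Admissible.H0 {x : Cube 𝒜 ι} {S : Finset ι} (h : x.Admissible S) {k : ι}
    (hk : k ∈ S) : (x.H0 k).Admissible (S.erase k) := by
  rw [Admissible] at h
  exact h.2 k hk

lemma admissible_iso_aux (m : ℕ) : ∀ (S : Finset ι), S.card = m → ∀ (x y : Cube 𝒜 ι) (_ : x ≅ y),
    x.Admissible S → y.Admissible S := by
  induction m with
  | zero =>
    intro S hS x y e h
    rw [Finset.card_eq_zero] at hS
    subst hS
    rw [Admissible]
    refine ⟨fun T hT k hk => absurd (hT hk) (by simp), fun k hk => absurd hk (by simp)⟩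
  | succ m ih =>
    intro S hS x y e h
    rw [Admissible]
    refine ⟨fun T hT k hk => ?_, fun k hk => ?_⟩
    · have := h.mono hT hk
      exact mono_of_square (f := x.bd T k) (cmpIso e T) (cmpIso e (T.erase k)).hom
        (bd_cmp e.hom T k) inferInstance
    · refine ih _ ?_ _ _ (H0iso e k) (h.H0 hk)
      rw [Finset.card_erase_of_mem hk]; omega

lemma Admissible.iso {S : Finset ι} {x y : Cube 𝒜 ι} (h : x.Admissible S) (e : x ≅ y) :
    y.Admissible S := admissible_iso_aux _ S rfl x y e h

lemma admissible_res_aux (m : ℕ) : ∀ (S' : Finset ι), S'.card = m →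
    ∀ (S U V : Finset ι) (x : Cube 𝒜 ι), x.Admissible S → S' ∪ V ⊆ S → S' ⊆ U → Disjoint S' V →
    (x.res U V).Admissible S' := by
  induction m with
  | zero =>
    intro S' hS' S U V x h h1 h2 h3
    rw [Finset.card_eq_zero] at hS'
    subst hS'
    rw [Admissible]
    refine ⟨fun T hT k hk => absurd (hT hk) (by simp), fun k hk => absurd hk (by simp)⟩
  | succ m ih =>
    intro S' hS' S U V x h h1 h2 h3
    rw [Admissible]
    refine ⟨fun T hT k hk => ?_, fun k hk => ?_⟩
    · have hkU := h2 (hT hk)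
      have hkV : k ∉ V := Finset.disjoint_left.1 h3 (hT hk)
      apply mono_bd_iff _ (Finset.insert_erase hk)
      rw [bd_res x hkU hkV]
      have : Mono (x.bd (insert k ((T.erase k ∩ U) ∪ V)) k) := by
        apply h.mono _ (by simp)
        intro a ha
        apply h1
        simp only [Finset.mem_insert, Finset.mem_union, Finset.mem_inter, Finset.mem_erase] at ha
        rcases ha with rfl | ⟨⟨_, h⟩, _⟩ | h
        · exact Finset.mem_union_left _ (hT hk)
        · exact Finset.mem_union_left _ (hT h)
        · exact Finset.mem_union_right _ h
      have e1 : IsIso (x.mapLE (set_aux1 (V := V) hkU (T.erase k)).le) :=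
        (x.isoLE (set_aux1 (V := V) hkU (T.erase k)).symm).isIso_hom
      have e2 : IsIso (x.mapLE (set_aux2 (U := U) hkV (T.erase k)).ge) :=
        (x.isoLE (set_aux2 (U := U) hkV (T.erase k))).isIso_hom
      infer_instance
    · have hkU := h2 hk
      have hkV : k ∉ V := Finset.disjoint_left.1 h3 hk
      refine (ih (S'.erase k) ?_ (S.erase k) U V (x.H0 k) (h.H0 (h1 (Finset.mem_union_left _ hk)))
        ?_ ((Finset.erase_subset _ _).trans h2) (h3.mono_left (Finset.erase_subset _ _))).iso
        (x.resIso hkU hkV).symm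
      · rw [Finset.card_erase_of_mem hk]; omega
      · intro a ha
        rw [Finset.mem_union, Finset.mem_erase] at ha
        rw [Finset.mem_erase]
        rcases ha with ⟨h4, h5⟩ | h4
        · exact ⟨h4, h1 (Finset.mem_union_left _ h5)⟩
        · exact ⟨fun h5 => hkV (h5 ▸ h4), h1 (Finset.mem_union_right _ h4)⟩

lemma Admissible.face1 {S : Finset ι} {x : Cube 𝒜 ι} (h : x.Admissible S) {k : ι} (hk : k ∈ S) :
    (x.res (S.erase k) {k}).Admissible (S.erase k) := by
  refine admissible_res_aux _ _ rfl S _ _ x h ?_ subset_rfl ?_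
  · exact Finset.union_subset (Finset.erase_subset _ _) (by simpa using hk)
  · simp

lemma Admissible.face0 {S : Finset ι} {x : Cube 𝒜 ι} (h : x.Admissible S) {k : ι} :
    (x.res (S.erase k) ∅).Admissible (S.erase k) := by
  refine admissible_res_aux _ _ rfl S _ _ x h ?_ subset_rfl ?_
  · exact Finset.union_subset (Finset.erase_subset _ _) (by simp)
  · simp

lemma Admissible.H0s {S : Finset ι} {x : Cube 𝒜 ι} (h : x.Admissible S) : ∀ (l : List ι),
    l.Nodup → (∀ k ∈ l, k ∈ S) → (x.H0s l).Admissible (S \ l.toFinset)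
  | [], _, _ => by simpa [Cube.H0s] using h
  | k :: ks, hn, hm => by
    rw [List.nodup_cons] at hn
    have := (Admissible.H0s h ks hn.2 (fun j hj => hm j (by simp [hj]))).H0 (k := k)
      (by simp [hn.1, hm k (by simp)])
    rw [List.toFinset_cons, Finset.sdiff_insert]
    exact this

/-- augmentation of the total complex -/
noncomputable def qa {x y : Cube 𝒜 ι} (S : Finset ι) (a : x ⟶ y) :
    x.totObj S 0 ⟶ y.vtx ∅ :=
  tdesc _ _ _ fun T => x.mapLE (Finset.empty_subset T) ≫ cmp a ∅

/-- augmentation of the total complex -/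
noncomputable def q (x : Cube 𝒜 ι) (S : Finset ι) (l : List ι) :
    x.totObj S 0 ⟶ (x.H0s l).vtx ∅ := qa S (x.augs l)

lemma inT_qa {x y : Cube 𝒜 ι} (S : Finset ι) (a : x ⟶ y) :
    x.inT S 0 ∅ ≫ qa S a = cmp a ∅ := by
  rw [qa, inT_tdesc _ _ _ _ (Finset.empty_subset _) (by simp), mapLE_refl, Category.id_comp]

lemma inT_q (x : Cube 𝒜 ι) (S : Finset ι) (l : List ι) :
    x.inT S 0 ∅ ≫ x.q S l = cmp (x.augs l) ∅ := inT_qa S _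

lemma tot0_hom_ext (x : Cube 𝒜 ι) (S : Finset ι) {Z : 𝒜} {f g : x.totObj S 0 ⟶ Z}
    (h : x.inT S 0 ∅ ≫ f = x.inT S 0 ∅ ≫ g) : f = g := by
  apply tot_hom_ext
  intro T _ hc
  rw [Finset.card_eq_zero] at hc
  subst hc
  exact h

/-- the induced map -/
noncomputable def phi (x : Cube 𝒜 ι) (U : Finset ι) (k : ι) (l : List ι) :
    ((x.res U {k}).H0s l).vtx ∅ ⟶ ((x.res U ∅).H0s l).vtx ∅ :=
  cmp (H0smap (x.tau U (Finset.empty_subset {k})) l) ∅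

lemma q_phi (x : Cube 𝒜 ι) (U : Finset ι) (k : ι) (l : List ι) :
    (x.res U {k}).q U l ≫ x.phi U k l =
      totMap (x.tau U (Finset.empty_subset {k})) U 0 ≫ (x.res U ∅).q U l := by
  apply tot0_hom_ext
  rw [← Category.assoc, inT_q, inT_totMap_assoc _ _ _ (Finset.empty_subset _) (by simp), inT_q,
    phi, ← cmp_comp, ← cmp_comp, augs_nat]

lemma wA_aux {U W : Finset ι} {k : ι} (hW : W = {k}) : (∅ ∩ U) ∪ {k} = W := by
  simp [hW]

lemma wB_aux {U W : Finset ι} {k : ι} (hW : W = {k}) : (∅ ∩ U) ∪ ∅ = W.erase k := by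
  simp [hW]

/-- vertex isomorphism -/
noncomputable def isoA (x : Cube 𝒜 ι) (U : Finset ι) (k : ι) (l : List ι)
    (hl : ∀ j ∈ l, j ∈ U ∧ j ∉ ({k} : Finset ι)) {W : Finset ι} (hW : W = {k}) :
    ((x.res U {k}).H0s l).vtx ∅ ≅ (x.H0s l).vtx W :=
  cmpIso (x.ressIso U {k} l hl) ∅ ≪≫ (x.H0s l).E U {k} ∅ ≪≫ (x.H0s l).isoLE (wA_aux hW)

/-- vertex isomorphism -/
noncomputable def isoB (x : Cube 𝒜 ι) (U : Finset ι) (k : ι) (l : List ι)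
    (hl : ∀ j ∈ l, j ∈ U ∧ j ∉ (∅ : Finset ι)) {W : Finset ι} (hW : W = {k}) :
    ((x.res U ∅).H0s l).vtx ∅ ≅ (x.H0s l).vtx (W.erase k) :=
  cmpIso (x.ressIso U ∅ l hl) ∅ ≪≫ (x.H0s l).E U ∅ ∅ ≪≫ (x.H0s l).isoLE (wB_aux hW)

lemma phi_comm (x : Cube 𝒜 ι) (U : Finset ι) (k : ι) (l : List ι)
    (h1 : ∀ j ∈ l, j ∈ U ∧ j ∉ ({k} : Finset ι)) (h2 : ∀ j ∈ l, j ∈ U ∧ j ∉ (∅ : Finset ι))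
    {W : Finset ι} (hW : W = {k}) :
    x.phi U k l ≫ (x.isoB U k l h2 hW).hom = (x.isoA U k l h1 hW).hom ≫ (x.H0s l).bd W k := by
  have := congrArg (fun t => cmp t ∅) (tau_ressIso x U (Finset.empty_subset {k}) l h1 h2)
  simp only [cmp_comp, cmp_tau] at this
  simp only [phi, isoB, isoA, Iso.trans_hom, cmpIso_hom, isoLE_hom, Category.assoc, bd]
  rw [reassoc_of% this]
  simp [mapLE_mapLE]

/-- the cokernel presentation -/
noncomputable def psi (x : Cube 𝒜 ι) (U : Finset ι) (k : ι) (l : List ι)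
    (h2 : ∀ j ∈ l, j ∈ U ∧ j ∉ (∅ : Finset ι)) :
    ((x.res U ∅).H0s l).vtx ∅ ⟶ ((x.H0s l).H0 k).vtx ∅ :=
  (x.isoB U k l h2 (W := insert k ∅) (by simp)).hom ≫ (x.H0s l).H0π k ∅

instance (x : Cube 𝒜 ι) (U : Finset ι) (k : ι) (l : List ι)
    (h2 : ∀ j ∈ l, j ∈ U ∧ j ∉ (∅ : Finset ι)) : Epi (x.psi U k l h2) := by
  unfold psi; exact epi_comp _ _

lemma exRef_H0π (x : Cube 𝒜 ι) (k : ι) (T : Finset ι) :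
    ExRef (x.bd (insert k T) k) (x.H0π k T) :=
  exRef_of_exact (ShortComplex.exact_cokernel (x.bd (insert k T) k))

lemma phi_psi (x : Cube 𝒜 ι) (U : Finset ι) (k : ι) (l : List ι)
    (h1 : ∀ j ∈ l, j ∈ U ∧ j ∉ ({k} : Finset ι)) (h2 : ∀ j ∈ l, j ∈ U ∧ j ∉ (∅ : Finset ι)) :
    x.phi U k l ≫ x.psi U k l h2 = 0 := by
  rw [psi, ← Category.assoc, phi_comm x U k l h1 h2, Category.assoc, bd_H0π, comp_zero]

lemma exRef_phi_psi (x : Cube 𝒜 ι) (U : Finset ι) (k : ι) (l : List ι)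
    (h1 : ∀ j ∈ l, j ∈ U ∧ j ∉ ({k} : Finset ι)) (h2 : ∀ j ∈ l, j ∈ U ∧ j ∉ (∅ : Finset ι)) :
    ExRef (x.phi U k l) (x.psi U k l h2) := by
  intro W z hz
  rw [psi, ← Category.assoc] at hz
  obtain ⟨W', p, hp, y, hy⟩ := exRef_H0π _ _ _ _ hz
  refine ⟨W', p, hp, y ≫ (x.isoA U k l h1 (W := insert k ∅) (by simp)).inv, ?_⟩
  rw [← cancel_mono (x.isoB U k l h2 (W := insert k ∅) (by simp)).hom, Category.assoc,
    Category.assoc, hy, Category.assoc, phi_comm x U k l h1 h2]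
  simp

lemma inr_q (x : Cube 𝒜 ι) {S : Finset ι} {k : ι} (l : List ι) (hk : k ∈ S)
    (h2 : ∀ j ∈ l, j ∈ S.erase k ∧ j ∉ (∅ : Finset ι)) :
    (x.cone hk).inr 0 ≫ qa S (x.augs l ≫ (x.H0s l).aug k) =
      (x.res (S.erase k) ∅).q (S.erase k) l ≫ x.psi (S.erase k) k l h2 := by
  apply tot0_hom_ext
  have h := congrArg (fun t => cmp t ∅) (augs_ressIso x (S.erase k) ∅ l h2)
  simp only [cmp_comp, cmp_resmap] at h
  change _ ≫ x.cInr S k 0 ≫ _ = _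
  rw [← Category.assoc, inT_cInr _ _ (Finset.empty_subset _) (by simp), ← Category.assoc _ (q _ _ _),
    inT_q, Category.assoc, Category.assoc, inT_qa, psi, isoB]
  simp only [Iso.trans_hom, cmpIso_hom, isoLE_hom, Category.assoc, inT_q]
  rw [reassoc_of% h]
  rw [cmp_comp, cmp_aug _ _ _ (by simp)]
  simp only [Category.assoc, Iso.inv_hom_id_assoc, mapLE_cmp_assoc, mapLE_mapLE_assoc]

lemma hl_aux1 {S : Finset ι} {k : ι} {l : List ι} (hl : l.toFinset = S.erase k) :
    ∀ j ∈ l, j ∈ S.erase k ∧ j ∉ ({k} : Finset ι) := by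
  intro j hj
  have : j ∈ S.erase k := by rw [← hl]; simpa using hj
  exact ⟨this, by simpa using Finset.ne_of_mem_erase this⟩

lemma hl_aux2 {S : Finset ι} {k : ι} {l : List ι} (hl : l.toFinset = S.erase k) :
    ∀ j ∈ l, j ∈ S.erase k ∧ j ∉ (∅ : Finset ι) := by
  intro j hj
  exact ⟨(hl_aux1 hl j hj).1, by simp⟩

lemma exRef_of_mono {A : ℕ → 𝒜} {dA : ∀ n, A (n+1) ⟶ A n} {B : ℕ → 𝒜}
    {dB : ∀ n, B (n+1) ⟶ B n} {C : ℕ → 𝒜} {dC : ∀ n, C (n+1) ⟶ C n}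
    {f : ∀ n, A n ⟶ B n} (D : ConeData A dA B dB C dC f)
    {M N : 𝒜} {α : A 0 ⟶ M} {β : B 0 ⟶ N} (hA : ResSeq A dA M α)
    (hB : ResSeq B dB N β) (hw : ∀ n, dC (n+1) ≫ dC n = 0)
    (φ : M ⟶ N) (hφ : α ≫ φ = f 0 ≫ β) [Mono φ] : ExRef (dC 1) (dC 0) := by
  obtain ⟨e⟩ := D.homology_iso hA hB hw φ hφ
  apply exRef_of_exact (w := hw 0)
  rw [ShortComplex.exact_iff_isZero_homology]
  exact (isZero_kernel_of_mono φ).of_iso e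

theorem resSeq : ∀ (l : List ι) (x : Cube 𝒜 ι) (S : Finset ι), l.Nodup → l.toFinset = S →
    x.Admissible S →
    ResSeq (fun n => x.totObj S n) (fun n => x.totD S n) ((x.H0s l).vtx ∅) (x.q S l)
  | [], x, S, _, hS, _ => by
    have hS' : S = ∅ := by simpa using hS.symm
    subst hS'
    have hz : ∀ n, IsZero (x.totObj ∅ (n+1)) := by
      intro n
      rw [IsZero.iff_id_eq_zero]
      apply tot_hom_ext
      intro T hT hc
      have := Finset.card_le_card hT
      simp [hc] at this
    have hq : qa ∅ (𝟙 x) ≫ x.inT ∅ 0 ∅ = 𝟙 _ := by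
      apply tot0_hom_ext
      rw [← Category.assoc, inT_qa, Category.comp_id, cmp_id, Category.id_comp]
    have hq' : x.inT ∅ 0 ∅ ≫ qa ∅ (𝟙 x) = 𝟙 _ := by
      rw [inT_qa, cmp_id]
    change ResSeq (fun n => x.totObj ∅ n) (fun n => x.totD ∅ n) (x.vtx ∅) (qa ∅ (𝟙 x))
    refine ⟨fun n W z _ => ⟨W, 𝟙 _, inferInstance, 0, (hz n).eq_of_tgt _ _⟩,
      fun W z hzz => ⟨W, 𝟙 _, inferInstance, 0, ?_⟩, ?_, (hz 0).eq_of_src _ _⟩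
    · rw [Category.id_comp, zero_comp, ← Category.comp_id z]
      change z ≫ 𝟙 (x.totObj ∅ 0) = 0
      rw [← hq, ← Category.assoc, hzz, zero_comp]
    · have : Epi (x.inT ∅ 0 ∅ ≫ qa ∅ (𝟙 x)) := by rw [hq']; infer_instance
      exact epi_of_epi (x.inT ∅ 0 ∅) _
  | k :: ks, x, S, hn, hS, hadm => by
    rw [List.nodup_cons] at hn
    have hk : k ∈ S := by rw [← hS]; simp
    have hl : ks.toFinset = S.erase k := by
      rw [← hS, List.toFinset_cons, Finset.erase_insert (by simpa using hn.1)]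
    have RA := resSeq ks _ _ hn.2 hl (hadm.face1 hk)
    have RB := resSeq ks _ _ hn.2 hl (hadm.face0 (k := k))
    have h1 := hl_aux1 hl
    have h2 := hl_aux2 hl
    have hphi := x.q_phi (S.erase k) k ks
    have hm : Mono (x.phi (S.erase k) k ks) := by
      have : Mono ((x.H0s ks).bd {k} k) := by
        refine (hadm.H0s ks hn.2 fun j hj => Finset.mem_of_mem_erase (h1 j hj).1).mono ?_ (by simp)
        simp [hk, hn.1]
      have h3 := phi_comm x (S.erase k) k ks h1 h2 (W := {k}) rfl
      have : Mono (x.phi (S.erase k) k ks ≫ (x.isoB (S.erase k) k ks h2 (W := {k}) rfl).hom) := by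
        rw [h3]; infer_instance
      exact mono_of_mono _ (x.isoB (S.erase k) k ks h2 (W := {k}) rfl).hom
    have R := (x.cone hk).res RA RB (x.totD_comp S) _ hphi (x.psi (S.erase k) k ks h2)
      (x.phi_psi _ k ks h1 h2) (x.exRef_phi_psi _ k ks h1 h2) (qa S (x.augs ks ≫ (x.H0s ks).aug k)) (x.inr_q ks hk h2)
    change ResSeq (fun n => x.totObj S n) (fun n => x.totD S n) (((x.H0s ks).H0 k).vtx ∅)
      (qa S (x.augs ks ≫ (x.H0s ks).aug k))
    refine ⟨fun n => ?_, R.2.2, R.1, R.2.1⟩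
    cases n with
    | zero => exact exRef_of_mono (x.cone hk) RA RB (x.totD_comp S) _ hphi
    | succ n => exact (x.cone hk).exact_high RA RB (x.totD_comp S) n

lemma coker_iso {X Y Z : 𝒜} {f : X ⟶ Y} {g : Y ⟶ Z} (w : f ≫ g = 0) (h : ExRef f g) (hg : Epi g) :
    Nonempty (cokernel f ≅ Z) := by
  have hex := h.exact w
  have : Epi (ShortComplex.mk f g w).g := hg
  exact ⟨(cokernelIsCokernel f).coconePointUniqueUpToIso hex.gIsCokernel⟩

end Final

end Cube

/-- Let `S` be a nonempty finite set and `x` an `S`-cube in an abelian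
category all of whose faces are admissible.  Then `Tot x` is a complex with
`H_p(Tot x) = 0` for `p ≥ 2` (exactness in degrees `≥ 2`), and for every `k ∈ S`,
`H_1(Tot x) ≅ H¹ₖ(H⁰_{S∖{k}}(x))` (the kernel of the boundary morphism of the `{k}`-cube
obtained by iterating the cokernel functors over `S ∖ {k}`) and
`H_0(Tot x) ≅ H⁰ₖ(H⁰_{S∖{k}}(x))` (its cokernel).  In particular, if `x` is admissible then
`Tot x` is exact in every positive degree and `H_0(Tot x) ≅ H⁰_S(x)`, the iterated cokernel
of `x` over all directions. -/
theorem homology_of_tot_of_cube_with_admissible_faces {𝒜 : Type u}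
    [Category.{v} 𝒜] [Abelian 𝒜] {ι : Type w} [LinearOrder ι]
    (x : Cube 𝒜 ι) (S : Finset ι) (hS : S.Nonempty)
    (hfaces : ∀ k ∈ S, (x.res (S.erase k) {k}).Admissible (S.erase k) ∧
      (x.res (S.erase k) ∅).Admissible (S.erase k)) :
    ∃ w : ∀ n : ℕ, x.totD S (n+1) ≫ x.totD S n = 0,
      (∀ n : ℕ, (ShortComplex.mk (x.totD S (n+2)) (x.totD S (n+1)) (w (n+1))).Exact) ∧
      (∀ k ∈ S, ∀ l : List ι, l.Nodup → l.toFinset = S.erase k →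
        Nonempty ((ShortComplex.mk (x.totD S 1) (x.totD S 0) (w 0)).homology ≅
          kernel ((x.H0s l).bd {k} k)) ∧
        Nonempty ((cokernel (x.totD S 0) : 𝒜) ≅ cokernel ((x.H0s l).bd {k} k))) ∧
      (x.Admissible S →
        (∀ n : ℕ, (ShortComplex.mk (x.totD S (n+1)) (x.totD S n) (w n)).Exact) ∧
        ∀ l : List ι, l.Nodup → l.toFinset = S →
          Nonempty ((cokernel (x.totD S 0) : 𝒜) ≅ (x.H0s l).vtx ∅)) := by
  refine ⟨x.totD_comp S, ?_, ?_, ?_⟩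
  · intro n
    obtain ⟨k, hk⟩ := hS
    have hl : (S.erase k).toList.toFinset = S.erase k := Finset.toList_toFinset _
    have RA := Cube.resSeq _ _ _ (Finset.nodup_toList _) hl (hfaces k hk).1
    have RB := Cube.resSeq _ _ _ (Finset.nodup_toList _) hl (hfaces k hk).2
    exact ((x.cone hk).exact_high RA RB (x.totD_comp S) n).exact _
  · intro k hk l hn hl
    have RA := Cube.resSeq _ _ _ hn hl (hfaces k hk).1
    have RB := Cube.resSeq _ _ _ hn hl (hfaces k hk).2
    have h1 := Cube.hl_aux1 hl
    have h2 := Cube.hl_aux2 hl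
    have hphi := x.q_phi (S.erase k) k l
    have hc := x.phi_comm (S.erase k) k l h1 h2 (W := {k}) rfl
    constructor
    · obtain ⟨e⟩ := (x.cone hk).homology_iso RA RB (x.totD_comp S) _ hphi
      exact ⟨e ≪≫ kernel.mapIso _ _ (x.isoA (S.erase k) k l h1 rfl)
        (x.isoB (S.erase k) k l h2 rfl) hc⟩
    · have R := (x.cone hk).res RA RB (x.totD_comp S) _ hphi (cokernel.π (x.phi (S.erase k) k l))
        (cokernel.condition _) (exRef_of_exact (ShortComplex.exact_cokernel _))
        ((x.cone hk).snd 0 ≫ (x.res (S.erase k) ∅).q (S.erase k) l ≫ cokernel.π _)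
        (by rw [← Category.assoc, (x.cone hk).inr_snd, Category.id_comp])
      obtain ⟨e⟩ := Cube.coker_iso R.2.1 R.2.2 R.1
      exact ⟨e ≪≫ cokernel.mapIso _ _ (x.isoA (S.erase k) k l h1 rfl)
        (x.isoB (S.erase k) k l h2 rfl) hc⟩
  · intro hadm
    refine ⟨fun n => ?_, fun l hn hl => ?_⟩
    · exact ((Cube.resSeq _ x S (Finset.nodup_toList _) (Finset.toList_toFinset S) hadm).ex
        n).exact _
    · have R := Cube.resSeq l x S hn hl hadm
      exact Cube.coker_iso R.w R.ex0 R.epi
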